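/- Let d ∈ (0,1), α > -d, n ≥ 1, and let C be a partition of {1,…,n}. Then the (infinite) sum over all z ∈ (ℕ₊)ⁿ with C_z = C of ∏_{j=1}^{m(z)} ( (α+(j−1)d) / (g_j(z)+α+(j−1)d) ) converges and equals d^{|C|} · (α/d)_{(|C|)} / ∏_{c ∈ C} (|c| − d). -/

import Mathlib

open MeasureTheory Finset

/-- Rising factorial `(x)_{(n)} = ∏_{j=0}^{n-1} (x+j)`. -/
noncomputable def risingFactorial (x : ℝ) (n : ℕ) : ℝ := ∏ j ∈ Finset.range n, (x + j)

/-- Beta function `B(a,b) = Γ(a)Γ(b)/Γ(a+b)`. -/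
noncomputable def betaFn (a b : ℝ) : ℝ := Real.Gamma a * Real.Gamma b / Real.Gamma (a + b)

/-- The partition of `{1,…,n}` induced by an allocation vector `z ∈ (ℕ₊)ⁿ`:
its blocks are the nonempty level sets `{i : z_i = j}`. -/
def Cz {n : ℕ} (z : Fin n → ℕ+) : Finset (Finset (Fin n)) :=
  Finset.image (fun i => Finset.univ.filter fun i' => z i' = z i) Finset.univ

/-- `m(z) = max {z₁,…,zₙ}`. -/
def mz {n : ℕ} (z : Fin n → ℕ+) : ℕ := Finset.univ.sup fun i => (z i : ℕ)

/-- `g_j(z) = #{i : z_i ≥ j}`. -/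
def gz {n : ℕ} (z : Fin n → ℕ+) (j : ℕ) : ℕ :=
  (Finset.univ.filter fun i => j ≤ (z i : ℕ)).card

/-- Access the `j`-th coordinate (1-indexed) of a vector `v : Fin m → ℝ`. -/
noncomputable def stk {m : ℕ} (v : Fin m → ℝ) (j : ℕ) : ℝ :=
  if h : j - 1 < m then v ⟨j - 1, h⟩ else 0

/-- `C` is a partition of `{1,…,n}`: all blocks are nonempty and every element
belongs to exactly one block. -/
def IsPartition {n : ℕ} (C : Finset (Finset (Fin n))) : Prop :=
  (∀ c ∈ C, c.Nonempty) ∧ ∀ i : Fin n, ∃! c, c ∈ C ∧ i ∈ c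

section StickBreaking

variable {ι : Type*} [Fintype ι] [DecidableEq ι]

/-- Injective labellings of the elements of `s` by `{1,…,M}`, extended by `0` outside `s`. -/
def labellings (s : Finset ι) (M : ℕ) : Finset (ι → ℕ) :=
  open Classical in
  (Fintype.piFinset fun c => if c ∈ s then Icc 1 M else {0}).filter fun z => Set.InjOn z s

/-- The product attached to a labelling `z`, for blocks of sizes `w`. -/
noncomputable def labellingWeight (w : ι → ℝ) (d α : ℝ) (z : ι → ℕ) : ℝ :=
  ∏ j ∈ range (univ.sup z),
    (α + j * d) / ((∑ c ∈ univ.filter fun c => j < z c, w c) + α + j * d)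

/-- The closed form of the sum of `labellingWeight` over all labellings of `s`. -/
noncomputable def labellingSum (w : ι → ℝ) (d α : ℝ) (s : Finset ι) : ℝ :=
  (∏ i ∈ range s.card, (α + i * d)) / ∏ c ∈ s, (w c - d)

lemma mem_labellings {s : Finset ι} {M : ℕ} {z : ι → ℕ} :
    z ∈ labellings s M ↔
      (∀ c ∈ s, 1 ≤ z c ∧ z c ≤ M) ∧ (∀ c ∉ s, z c = 0) ∧ Set.InjOn z s := by
  classical
  simp only [labellings, mem_filter, Fintype.mem_piFinset, ← and_assoc]
  refine and_congr_left fun _ => ⟨fun h => ⟨fun c hc => ?_, fun c hc => ?_⟩, fun h c => ?_⟩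
  · simpa [hc] using h c
  · simpa [hc] using h c
  · by_cases hc : c ∈ s
    · simpa [hc] using h.1 c hc
    · simpa [hc] using h.2 c hc

lemma labellings_empty (M : ℕ) : labellings (∅ : Finset ι) M = {0} := by
  ext z
  simp [mem_labellings, funext_iff]

lemma labellings_zero {s : Finset ι} (hs : s.Nonempty) : labellings s 0 = ∅ := by
  obtain ⟨c, hc⟩ := hs
  refine eq_empty_of_forall_notMem fun z hz => ?_
  have := (mem_labellings.1 hz).1 c hc
  omega

lemma labellings_mono (s : Finset ι) : Monotone (labellings s) := fun M N h z hz => by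
  rw [mem_labellings] at hz ⊢
  exact ⟨fun c hc => ⟨(hz.1 c hc).1, (hz.1 c hc).2.trans h⟩, hz.2⟩

lemma support_eq_of_mem_labellings {s : Finset ι} {M : ℕ} {z : ι → ℕ} (hz : z ∈ labellings s M) :
    s = univ.filter fun c => z c ≠ 0 := by
  ext c
  rw [mem_labellings] at hz
  by_cases hc : c ∈ s
  · have := hz.1 c hc
    simp [hc]; omega
  · simp [hc, hz.2.1 c hc]

/-- Removing the label `1` and shifting the other labels down. -/
lemma sum_labellings_succ (s : Finset ι) (M : ℕ) (φ : (ι → ℕ) → ℝ) :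
    ∑ z ∈ labellings s (M + 1), φ (fun c => z c - 1) =
      ∑ z ∈ labellings s M, φ z + ∑ c ∈ s, ∑ z ∈ labellings (s.erase c) M, φ z := by
  rw [← sum_biUnion, ← sum_union]
  · refine sum_nbij' (fun z c => z c - 1) (fun z c => z c + if c ∈ s then 1 else 0)
      ?_ ?_ ?_ ?_ ?_
    · intro z hz
      rw [mem_labellings] at hz
      obtain ⟨h1, h2, h3⟩ := hz
      simp only [mem_union, mem_biUnion, mem_labellings]
      by_cases h : ∃ c ∈ s, z c = 1
      · obtain ⟨c, hc, hzc⟩ := h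
        refine Or.inr ⟨c, hc, fun b hb => ?_, fun b hb => ?_, fun a ha b hb hab => ?_⟩
        · have hb' := mem_of_mem_erase hb
          have := h1 b hb'
          have : z b ≠ 1 := fun h => ne_of_mem_erase hb (h3 hb' hc (h.trans hzc.symm))
          omega
        · by_cases hbs : b ∈ s
          · have : b = c := by simpa [hbs] using hb
            simp [this, hzc]
          · simp [h2 b hbs]
        · have ha' := mem_of_mem_erase (mem_coe.1 ha)
          have hb' := mem_of_mem_erase (mem_coe.1 hb)
          have := h1 a ha'
          have := h1 b hb'
          exact h3 ha' hb' (by simp only at hab; omega)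
      · push Not at h
        refine Or.inl ⟨fun b hb => ?_, fun b hb => ?_, fun a ha b hb hab => ?_⟩
        · have := h1 b hb
          have := h b hb
          omega
        · simp [h2 b hb]
        · have := h1 a ha
          have := h1 b hb
          exact h3 ha hb (by simp only at hab; omega)
    · intro z hz
      simp only [mem_union, mem_biUnion, mem_labellings] at hz
      rw [mem_labellings]
      rcases hz with ⟨h1, h2, h3⟩ | ⟨c, hc, h1, h2, h3⟩
      · refine ⟨fun b hb => ?_, fun b hb => ?_, fun a ha b hb hab => ?_⟩
        · have := h1 b hb
          simp only [hb, if_true]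
          omega
        · simp [hb, h2 b hb]
        · rw [mem_coe] at ha hb
          simp only [ha, hb, if_true] at hab
          exact h3 ha hb (by omega)
      · have hzc : z c = 0 := h2 c (notMem_erase c s)
        refine ⟨fun b hb => ?_, fun b hb => ?_, fun a ha b hb hab => ?_⟩
        · simp only [hb, if_true]
          by_cases hbc : b = c
          · subst hbc; omega
          · have := h1 b (mem_erase.2 ⟨hbc, hb⟩)
            omega
        · have := h2 b fun h => hb (mem_of_mem_erase h)
          simp [hb, this]
        · rw [mem_coe] at ha hb
          simp only [ha, hb, if_true] at hab
          by_cases hac : a = c <;> by_cases hbc : b = c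
          · rw [hac, hbc]
          · have := h1 b (mem_erase.2 ⟨hbc, hb⟩)
            subst hac; omega
          · have := h1 a (mem_erase.2 ⟨hac, ha⟩)
            subst hbc; omega
          · exact h3 (mem_coe.2 (mem_erase.2 ⟨hac, ha⟩)) (mem_coe.2 (mem_erase.2 ⟨hbc, hb⟩))
              (by omega)
    · intro z hz
      rw [mem_labellings] at hz
      ext c
      by_cases hc : c ∈ s
      · have := hz.1 c hc
        simp only [hc, if_true]; omega
      · simp [hc, hz.2.1 c hc]
    · intro z hz
      have hz0 : ∀ c ∉ s, z c = 0 := by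
        intro b hb
        simp only [mem_union, mem_biUnion, mem_labellings] at hz
        rcases hz with h | ⟨c, -, h⟩
        · exact h.2.1 b hb
        · exact h.2.1 b fun h => hb (mem_of_mem_erase h)
      ext c
      by_cases hc : c ∈ s
      · simp [hc]
      · simp [hc, hz0 c hc]
    · intro z _
      rfl
  · rw [disjoint_biUnion_right]
    intro c hc
    rw [disjoint_left]
    intro z hz hz'
    have := (support_eq_of_mem_labellings hz).trans (support_eq_of_mem_labellings hz').symm
    exact notMem_erase c s (this ▸ hc)
  · intro a ha b hb hab
    rw [Function.onFun, disjoint_left]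
    intro z hz hz'
    have := (support_eq_of_mem_labellings hz).trans (support_eq_of_mem_labellings hz').symm
    exact notMem_erase a s (this ▸ mem_erase.2 ⟨hab, ha⟩)

lemma labellingWeight_eq_mul (w : ι → ℝ) (d α : ℝ) {s : Finset ι} (hs : s.Nonempty) {M : ℕ}
    {z : ι → ℕ} (hz : z ∈ labellings s M) :
    labellingWeight w d α z =
      α / (∑ c ∈ s, w c + α) * labellingWeight w d (α + d) (fun c => z c - 1) := by
  have hsup : univ.sup z = univ.sup (fun c => z c - 1) + 1 := by
    obtain ⟨c, hc⟩ := hs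
    have h1 := ((mem_labellings.1 hz).1 c hc).1
    have h2 : z c ≤ univ.sup z := le_sup (mem_univ c)
    refine le_antisymm (Finset.sup_le fun b _ => ?_) ?_
    · have := le_sup (f := fun c => z c - 1) (mem_univ b)
      omega
    · have : univ.sup (fun c => z c - 1) ≤ univ.sup z - 1 := Finset.sup_le fun b _ => by
        have : z b ≤ univ.sup z := le_sup (mem_univ b)
        omega
      omega
  rw [labellingWeight, labellingWeight, hsup, prod_range_succ', mul_comm]
  congr 1
  · simp only [support_eq_of_mem_labellings hz, Nat.pos_iff_ne_zero]
    simp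
  · refine prod_congr rfl fun j _ => ?_
    simp only [Nat.lt_sub_iff_add_lt]
    push_cast
    congr 1 <;> ring

omit [DecidableEq ι] in
lemma labellingWeight_nonneg {w : ι → ℝ} {d α : ℝ} (hw : ∀ c, d < w c) (hd : 0 < d) (hα : 0 ≤ α)
    (z : ι → ℕ) : 0 ≤ labellingWeight w d α z :=
  prod_nonneg fun j _ => by
    have : 0 ≤ ∑ c ∈ univ.filter fun c => j < z c, w c :=
      sum_nonneg fun c _ => (hd.trans (hw c)).le
    positivity

omit [Fintype ι] in
lemma labellingSum_eq_mul {w : ι → ℝ} {d α : ℝ} (hw : ∀ c, d < w c) {s : Finset ι}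
    (hs : s.Nonempty) (hα : ∑ c ∈ s, w c + α ≠ 0) :
    labellingSum w d α s = α / (∑ c ∈ s, w c + α) *
      (labellingSum w d (α + d) s + ∑ c ∈ s, labellingSum w d (α + d) (s.erase c)) := by
  obtain ⟨k, hk⟩ := Nat.exists_eq_succ_of_ne_zero hs.card_pos.ne'
  have hpos : ∏ c ∈ s, (w c - d) ≠ 0 := prod_ne_zero_iff.2 fun c _ => (sub_pos.2 (hw c)).ne'
  set P := ∏ i ∈ range k, (α + d + i * d) with hP
  have h1 : ∏ i ∈ range s.card, (α + i * d) = P * α := by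
    rw [hk, Nat.succ_eq_add_one, prod_range_succ']
    simp only [Nat.cast_zero, zero_mul, add_zero]
    congr 1
    exact prod_congr rfl fun i _ => by push_cast; ring
  have h2 : ∏ i ∈ range s.card, (α + d + i * d) = P * (α + s.card * d) := by
    rw [hk, Nat.succ_eq_add_one, prod_range_succ]
    push_cast
    ring
  have h3 : ∀ c ∈ s, labellingSum w d (α + d) (s.erase c) =
      P / (∏ c ∈ s, (w c - d)) * (w c - d) := by
    intro c hc
    have hc0 : w c - d ≠ 0 := (sub_pos.2 (hw c)).ne'
    rw [labellingSum, card_erase_of_mem hc, hk, Nat.succ_sub_one, ← hP,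
      ← mul_prod_erase s (fun c => w c - d) hc]
    field_simp
  rw [sum_congr rfl h3, ← mul_sum, sum_sub_distrib, labellingSum, labellingSum, h1, h2]
  simp only [sum_const, nsmul_eq_mul]
  field_simp
  ring

omit [Fintype ι] [DecidableEq ι] in
lemma labellingSum_add_mul (w : ι → ℝ) (d α : ℝ) (s : Finset ι) :
    labellingSum w d (α + d) s * α = labellingSum w d α s * (α + s.card * d) := by
  have h : (∏ i ∈ range s.card, (α + d + i * d)) * α =
      (∏ i ∈ range s.card, (α + i * d)) * (α + s.card * d) := by
    rw [← prod_range_succ (fun i : ℕ => α + i * d), prod_range_succ']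
    simp only [Nat.cast_zero, zero_mul, add_zero]
    congr 1
    exact prod_congr rfl fun i _ => by push_cast; ring
  rw [labellingSum, labellingSum, div_mul_eq_mul_div, h, mul_div_right_comm]

omit [Fintype ι] [DecidableEq ι] in
lemma labellingSum_pos {w : ι → ℝ} {d α : ℝ} (hw : ∀ c, d < w c) (hd : 0 < d) (hα : 0 < α)
    (s : Finset ι) : 0 < labellingSum w d α s :=
  div_pos (prod_pos fun i _ => by positivity) (prod_pos fun c _ => sub_pos.2 (hw c))

omit [DecidableEq ι] in
lemma labellingWeight_zero (w : ι → ℝ) (d α : ℝ) : labellingWeight w d α 0 = 1 := by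
  have : univ.sup (0 : ι → ℕ) = 0 := by simp
  rw [labellingWeight, this, range_zero, prod_empty]

omit [Fintype ι] [DecidableEq ι] in
lemma labellingSum_empty (w : ι → ℝ) (d α : ℝ) : labellingSum w d α ∅ = 1 := by
  simp [labellingSum]

lemma sum_labellingWeight_succ (w : ι → ℝ) (d α : ℝ) {s : Finset ι} (hs : s.Nonempty) (M : ℕ) :
    ∑ z ∈ labellings s (M + 1), labellingWeight w d α z = α / (∑ c ∈ s, w c + α) *
      (∑ z ∈ labellings s M, labellingWeight w d (α + d) z +
        ∑ c ∈ s, ∑ z ∈ labellings (s.erase c) M, labellingWeight w d (α + d) z) := by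
  rw [← sum_labellings_succ, mul_sum]
  exact sum_congr rfl fun z hz => labellingWeight_eq_mul w d α hs hz

lemma sum_labellingWeight_le {w : ι → ℝ} {d : ℝ} (hw : ∀ c, d < w c) (hd : 0 < d) (M : ℕ) :
    ∀ (s : Finset ι) {α : ℝ}, 0 < α →
      ∑ z ∈ labellings s M, labellingWeight w d α z ≤ labellingSum w d α s := by
  induction M with
  | zero =>
    intro s α hα
    rcases s.eq_empty_or_nonempty with rfl | hs
    · simp [labellings_empty, labellingWeight_zero, labellingSum_empty]
    · simpa [labellings_zero hs] using (labellingSum_pos hw hd hα s).le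
  | succ M ih =>
    intro s α hα
    rcases s.eq_empty_or_nonempty with rfl | hs
    · simp [labellings_empty, labellingWeight_zero, labellingSum_empty]
    · have hW : 0 ≤ ∑ c ∈ s, w c := sum_nonneg fun c _ => (hd.trans (hw c)).le
      rw [sum_labellingWeight_succ w d α hs, labellingSum_eq_mul hw hs (by positivity)]
      have hα' : 0 < α + d := by positivity
      gcongr
      · exact ih s hα'
      · exact ih _ hα'

lemma eq_zero_of_ratio_recursion {ρ : ℝ → ℝ} {d p q : ℝ} (hd : 0 < d) (hp : 0 ≤ p) (hpq : p < q)
    (h0 : ∀ α, 0 < α → 0 ≤ ρ α) (h1 : ∀ α, 0 < α → ρ α ≤ 1)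
    (hρ : ∀ α, 0 < α → ρ α * (α + q) = (α + p) * ρ (α + d)) {α : ℝ} (hα : 0 < α) : ρ α = 0 := by
  by_contra hne
  have hpos : 0 < ρ α := lt_of_le_of_ne (h0 α hα) (Ne.symm hne)
  have hq : 0 < q := hp.trans_lt hpq
  set κ := (q - p) * ρ α / (α + q + d) with hκ
  have hκ0 : 0 < κ := by
    have := sub_pos.2 hpq
    positivity
  have key : ∀ N : ℕ, ρ α + κ * ∑ i ∈ range N, 1 / ((i : ℝ) + 1) ≤ ρ (α + N * d) := by
    intro N
    induction N with
    | zero => simp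
    | succ N ih =>
      have hβ : 0 < α + N * d := by positivity
      have hrec := hρ _ hβ
      have hβ' : α + N * d + d = α + (N + 1 : ℕ) * d := by push_cast; ring
      rw [hβ'] at hrec
      have hge : ρ α ≤ ρ (α + N * d) := by
        refine le_trans ?_ ih
        have : 0 ≤ ∑ i ∈ range N, 1 / ((i : ℝ) + 1) := sum_nonneg fun i _ => by positivity
        nlinarith
      have hβp : 0 < α + N * d + p := by positivity
      have hstep : ρ (α + (N + 1 : ℕ) * d) =
          ρ (α + N * d) + (q - p) * ρ (α + N * d) / (α + N * d + p) := by
        have : ρ (α + (N + 1 : ℕ) * d) = ρ (α + N * d) * (α + N * d + q) / (α + N * d + p) := by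
          rw [eq_div_iff hβp.ne']
          linarith
        rw [this]
        field_simp
        ring
      have hle : κ * (1 / ((N : ℝ) + 1)) ≤ (q - p) * ρ (α + N * d) / (α + N * d + p) := by
        rw [hκ, div_mul_div_comm, mul_one]
        have h2 := sub_pos.2 hpq
        have : α + N * d + p ≤ (α + q + d) * (N + 1) := by
          have : 0 ≤ (α + q) * N := by positivity
          nlinarith
        have : 0 ≤ (q - p) * ρ (α + N * d) := mul_nonneg h2.le (h0 _ hβ)
        gcongr
      rw [sum_range_succ, mul_add, hstep]
      linarith
  have hdiv := Real.tendsto_sum_range_one_div_nat_succ_atTop.const_mul_atTop hκ0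
  obtain ⟨N, hN⟩ := (hdiv.eventually_gt_atTop 1).exists
  have := key N
  have := h1 (α + N * d) (by positivity)
  linarith

lemma tendsto_sum_labellingWeight {w : ι → ℝ} {d : ℝ} (hw : ∀ c, d < w c) (hd : 0 < d)
    (s : Finset ι) : ∀ {α : ℝ}, 0 < α →
      Filter.Tendsto (fun M => ∑ z ∈ labellings s M, labellingWeight w d α z) Filter.atTop
        (nhds (labellingSum w d α s)) := by
  induction s using Finset.strongInduction with
  | H s ih =>
  intro α hα
  rcases s.eq_empty_or_nonempty with rfl | hs
  · simp [labellings_empty, labellingWeight_zero, labellingSum_empty]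
  have hex : ∀ β : ℝ, ∃ L, 0 < β → Filter.Tendsto
      (fun M => ∑ z ∈ labellings s M, labellingWeight w d β z) Filter.atTop (nhds L) := by
    intro β
    by_cases hβ : 0 < β
    · refine ⟨_, fun _ => tendsto_atTop_ciSup (fun M N h => ?_)
        ⟨labellingSum w d β s, Set.forall_mem_range.2 fun M =>
          sum_labellingWeight_le hw hd M s hβ⟩⟩
      exact sum_le_sum_of_subset_of_nonneg (labellings_mono s h)
        fun z _ _ => labellingWeight_nonneg hw hd hβ.le z
    · exact ⟨0, fun h => absurd h hβ⟩
  choose L hL using hex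
  set W := ∑ c ∈ s, w c with hW
  have hWlt : s.card * d < W := by
    rw [hW, ← nsmul_eq_mul, ← sum_const]
    exact sum_lt_sum_of_nonempty hs fun c _ => hw c
  have hrec : ∀ β, 0 < β → L β =
      β / (W + β) * (L (β + d) + ∑ c ∈ s, labellingSum w d (β + d) (s.erase c)) := by
    intro β hβ
    have hβ' : 0 < β + d := by positivity
    refine tendsto_nhds_unique ((Filter.tendsto_add_atTop_iff_nat 1).2 (hL β hβ)) ?_
    simp only [sum_labellingWeight_succ w d β hs]
    exact ((hL _ hβ').add
      (tendsto_finsetSum _ fun c hc => ih _ (erase_ssubset hc) hβ')).const_mul _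
  have hW0 : 0 < W := lt_of_le_of_lt (by positivity) hWlt
  set ρ : ℝ → ℝ := fun β => 1 - L β / labellingSum w d β s with hρ
  have hρ0 : ρ α = 0 := by
    refine eq_zero_of_ratio_recursion hd (p := s.card * d) (q := W) (by positivity) hWlt
      (fun β hβ => ?_) (fun β hβ => ?_) (fun β hβ => ?_) hα
    · rw [hρ, sub_nonneg, div_le_one (labellingSum_pos hw hd hβ s)]
      exact le_of_tendsto' (hL β hβ) fun M => sum_labellingWeight_le hw hd M s hβ
    · rw [hρ, sub_le_self_iff]
      exact div_nonneg (ge_of_tendsto' (hL β hβ) fun M =>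
        sum_nonneg fun z _ => labellingWeight_nonneg hw hd hβ.le z)
        (labellingSum_pos hw hd hβ s).le
    · have hG := (labellingSum_pos hw hd hβ s).ne'
      have hG' := (labellingSum_pos hw hd (by positivity : 0 < β + d) s).ne'
      have hGrec := labellingSum_eq_mul (w := w) (d := d) (α := β) hw hs (by positivity)
      have hshift := labellingSum_add_mul w d β s
      have hWβ : W + β ≠ 0 := by positivity
      have hD : (labellingSum w d β s - L β) * (β + W) =
          β * (labellingSum w d (β + d) s - L (β + d)) := by
        rw [hrec β hβ, hGrec, ← hW]
        field_simp
        ring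
      refine mul_right_cancel₀ hG ?_
      simp only [hρ]
      calc (1 - L β / labellingSum w d β s) * (β + W) * labellingSum w d β s
          = (labellingSum w d β s - L β) * (β + W) := by field_simp
        _ = (labellingSum w d (β + d) s * β) * (1 - L (β + d) / labellingSum w d (β + d) s) := by
            rw [hD]; field_simp
        _ = _ := by rw [hshift]; ring
  have hLα : L α = labellingSum w d α s := by
    have hG := (labellingSum_pos hw hd hα s).ne'
    rw [hρ, sub_eq_zero, eq_comm, div_eq_one_iff_eq hG] at hρ0
    exact hρ0
  exact hLα ▸ hL α hα

lemma hasSum_of_tendsto_of_nonneg {β : Type*} {f : β → ℝ} (hf : ∀ b, 0 ≤ f b) {a : ℝ}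
    {t : ℕ → Finset β} (ht : Monotone t) (hex : ∀ b, ∃ M, b ∈ t M)
    (h : Filter.Tendsto (fun M => ∑ b ∈ t M, f b) Filter.atTop (nhds a)) : HasSum f a := by
  classical
  have hmono : Monotone fun u : Finset β => ∑ b ∈ u, f b := fun u v huv =>
    sum_le_sum_of_subset_of_nonneg huv fun b _ _ => hf b
  rw [HasSum, SummationFilter.unconditional_filter]
  exact (tendsto_iff_tendsto_subseq_of_monotone hmono
    (Filter.tendsto_atTop_finset_of_monotone ht hex)).2 h

lemma hasSum_labellingWeight [Nonempty ι] {w : ι → ℝ} {d α : ℝ} (hw : ∀ c, d < w c) (hd : 0 < d)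
    (hα : -d < α) :
    HasSum (fun z : {z : ι → ℕ // (∀ c, 1 ≤ z c) ∧ Function.Injective z} =>
      labellingWeight w d α z.1) (labellingSum w d α univ) := by
  classical
  have hmem : ∀ (z : {z : ι → ℕ // (∀ c, 1 ≤ z c) ∧ Function.Injective z}) (M : ℕ),
      univ.sup z.1 ≤ M → z.1 ∈ labellings univ M := fun z M hM =>
    mem_labellings.2 ⟨fun c _ => ⟨z.2.1 c, (le_sup (mem_univ c)).trans hM⟩, by simp, by
      simpa using z.2.2⟩
  have hα' : 0 < α + d := by linarith
  have hW : d < ∑ c, w c := by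
    obtain ⟨c⟩ := ‹Nonempty ι›
    exact (hw c).trans_le (single_le_sum (fun b _ => (hd.trans (hw b)).le) (mem_univ c))
  rw [labellingSum_eq_mul hw univ_nonempty (by linarith)]
  have heq : ∀ z : {z : ι → ℕ // (∀ c, 1 ≤ z c) ∧ Function.Injective z},
      labellingWeight w d α z.1 = α / (∑ c, w c + α) *
        labellingWeight w d (α + d) (fun c => z.1 c - 1) := fun z =>
    labellingWeight_eq_mul w d α univ_nonempty (hmem z _ le_rfl)
  simp only [heq]
  refine HasSum.mul_left _ ?_
  refine hasSum_of_tendsto_of_nonneg (fun z => labellingWeight_nonneg hw hd hα'.le _)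
    (t := fun M => (labellings univ (M + 1)).subtype _) (fun M N h => ?_) (fun z => ?_) ?_
  · exact subtype_mono (labellings_mono _ (by omega))
  · exact ⟨univ.sup z.1, mem_subtype.2 (hmem z _ (by omega))⟩
  · have hsub : ∀ M, ∑ z ∈ (labellings univ (M + 1)).subtype
        (fun z : ι → ℕ => (∀ c, 1 ≤ z c) ∧ Function.Injective z),
        labellingWeight w d (α + d) (fun c => z.1 c - 1) =
        ∑ z ∈ labellings univ M, labellingWeight w d (α + d) z +
          ∑ c, ∑ z ∈ labellings (univ.erase c) M, labellingWeight w d (α + d) z := fun M => by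
      rw [← sum_labellings_succ univ M (labellingWeight w d (α + d)),
        ← sum_subtype_of_mem (p := fun z : ι → ℕ => (∀ c, 1 ≤ z c) ∧ Function.Injective z)]
      intro z hz
      rw [mem_labellings] at hz
      exact ⟨fun c => (hz.1 c (mem_univ c)).1, by simpa using hz.2.2⟩
    simp only [hsub]
    exact (tendsto_sum_labellingWeight hw hd univ hα').add
      (tendsto_finsetSum _ fun c _ => tendsto_sum_labellingWeight hw hd _ hα')

end StickBreaking

/-- For a partition `C` of `{1,…,n}`, the sum over all `z ∈ (ℕ₊)ⁿ` with
`C_z = C` of `∏_{j=1}^{m(z)} (α+(j-1)d)/(g_j(z)+α+(j-1)d)` converges and equals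
`d^{|C|} (α/d)_{(|C|)} / ∏_{c∈C} (|c|-d)`. -/
theorem sum_over_allocations {n : ℕ} (hn : 1 ≤ n) (d α : ℝ)
    (hd : d ∈ Set.Ioo (0 : ℝ) 1) (hα : -d < α)
    (C : Finset (Finset (Fin n))) (hC : IsPartition C) :
    HasSum
      (fun z : {z : Fin n → ℕ+ // Cz z = C} =>
        ∏ j ∈ Finset.Icc 1 (mz z.1),
          (α + ((j : ℝ) - 1) * d) / ((gz z.1 j : ℝ) + α + ((j : ℝ) - 1) * d))
      (d ^ C.card * risingFactorial (α / d) C.card / ∏ c ∈ C, ((c.card : ℝ) - d)) := by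
  classical
  obtain ⟨hd0, hd1⟩ := hd
  have hex : ∀ i, ∃ c : C, i ∈ c.1 ∧ ∀ c' : C, i ∈ c'.1 → c' = c := fun i => by
    obtain ⟨c, ⟨hc, hi⟩, h⟩ := hC.2 i
    exact ⟨⟨c, hc⟩, hi, fun c' hc' => Subtype.ext (h c'.1 ⟨c'.2, hc'⟩)⟩
  choose blk hblk huniq using hex
  obtain ⟨rep, hrep⟩ : ∃ rep : C → Fin n, ∀ c, rep c ∈ c.1 :=
    ⟨fun c => (hC.1 c.1 c.2).choose, fun c => (hC.1 c.1 c.2).choose_spec⟩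
  have hblkrep : ∀ c, blk (rep c) = c := fun c => (huniq _ c (hrep c)).symm
  have hfiber : ∀ c : C, (univ.filter fun i => blk i = c) = c.1 := fun c => by
    ext i
    rw [mem_filter_univ]
    exact ⟨fun h => h ▸ hblk i, fun h => (huniq i c h).symm⟩
  have hlevel : ∀ z : Fin n → ℕ+, (∀ i i', z i' = z i ↔ blk i' = blk i) → Cz z = C := by
    intro z hz
    ext c
    simp only [Cz, mem_image, mem_univ, true_and, hz, hfiber]
    exact ⟨fun ⟨i, h⟩ => h ▸ (blk i).2, fun h => ⟨rep ⟨c, h⟩, by rw [hblkrep]⟩⟩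
  have hCz : ∀ y : {y : C → ℕ // (∀ c, 1 ≤ y c) ∧ Function.Injective y},
      Cz (fun i => (⟨y.1 (blk i), y.2.1 _⟩ : ℕ+)) = C := fun y =>
    hlevel _ fun i i' => Subtype.mk_eq_mk.trans y.2.2.eq_iff
  let Φ : {y : C → ℕ // (∀ c, 1 ≤ y c) ∧ Function.Injective y} → {z : Fin n → ℕ+ // Cz z = C} :=
    fun y => ⟨fun i => ⟨y.1 (blk i), y.2.1 _⟩, hCz y⟩
  have hΦ : Function.Bijective Φ := by
    refine ⟨fun y y' h => Subtype.ext (funext fun c => ?_), fun z => ?_⟩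
    · have := congrArg PNat.val (congrFun (congrArg Subtype.val h) (rep c))
      simpa [Φ, hblkrep] using this
    · have hz : ∀ i i', z.1 i' = z.1 i ↔ blk i' = blk i := by
        intro i i'
        have hmem : (univ.filter fun i' => z.1 i' = z.1 i) ∈ C :=
          z.2.subset (mem_image_of_mem _ (mem_univ i))
        have := huniq i ⟨_, hmem⟩ (by simp)
        rw [← mem_filter_univ (p := fun i' => z.1 i' = z.1 i), ← mem_filter_univ
          (p := fun i' => blk i' = blk i), hfiber, ← this]
      refine ⟨⟨fun c => z.1 (rep c), fun c => (z.1 (rep c)).pos, fun c c' h => ?_⟩,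
        Subtype.ext (funext fun i => PNat.eq ?_)⟩
      · have := (hz _ _).1 (PNat.eq h)
        rwa [hblkrep, hblkrep] at this
      · exact congrArg PNat.val ((hz i (rep (blk i))).2 (hblkrep _))
  have hw : ∀ c : C, d < (c.1.card : ℝ) := fun c =>
    hd1.trans_le (by exact_mod_cast (hC.1 c.1 c.2).card_pos)
  have : Nonempty C := ⟨blk ⟨0, hn⟩⟩
  have hsum := hasSum_labellingWeight hw hd0 hα
  rw [← (Equiv.ofBijective Φ hΦ).hasSum_iff]
  convert hsum using 1
  · funext y
    have hmz : mz (Φ y).1 = univ.sup y.1 := by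
      refine le_antisymm (Finset.sup_le fun i _ => le_sup (f := y.1) (mem_univ (blk i)))
        (Finset.sup_le fun c _ => ?_)
      have := le_sup (f := fun i => ((Φ y).1 i : ℕ)) (mem_univ (rep c))
      simpa [Φ, mz, hblkrep] using this
    have hgz : ∀ j, gz (Φ y).1 (j + 1) = ∑ c ∈ univ.filter fun c => j < y.1 c, c.1.card := by
      intro j
      rw [gz, card_eq_sum_card_fiberwise (f := blk) (t := univ.filter fun c => j < y.1 c)]
      · refine sum_congr rfl fun c hc => congrArg card ?_
        rw [mem_filter_univ] at hc
        rw [← hfiber c, filter_filter]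
        refine filter_congr fun i _ => and_iff_right_of_imp ?_
        rintro rfl
        exact hc
      · intro i hi
        simpa [Φ, Nat.succ_le_iff] using hi
    simp only [Function.comp_apply, Equiv.ofBijective_apply, hmz, labellingWeight]
    rw [← Ico_add_one_right_eq_Icc, prod_Ico_eq_prod_range, Nat.add_sub_cancel]
    refine prod_congr rfl fun j _ => ?_
    rw [add_comm 1 j, hgz]
    push_cast
    ring_nf
  · rw [labellingSum, prod_coe_sort C (fun c => (c.card : ℝ) - d), card_univ, Fintype.card_coe,
      risingFactorial, ← card_range C.card, ← prod_const, card_range, ← prod_mul_distrib]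
    congr 1
    refine prod_congr rfl fun i _ => ?_
    field_simp
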